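/- arXiv:2405.07253 — 2 statements merged into one kernel-verified Lean document; each statement's English description precedes it below -/
import Mathlib

section
/- Let μ be an absolutely continuous log-concave probability measure on ℝ. For every ε ∈ (0,1) and every x in the interior of the support of μ, Λ*_μ(x) ≥ (1−ε) log(1/q_μ(x)) + log(ε / 2^{1−ε}). -/
open MeasureTheory Real Set

/-- One-dimensional half-space depth: `q_μ(x) = min {μ(−∞,x], μ[x,∞)}`. -/
noncomputable def depth1 (μ : Measure ℝ) (x : ℝ) : ℝ :=
  min (μ (Set.Iic x)).toReal (μ (Set.Ici x)).toReal

/-- Cramér transform of a probability measure on `ℝ`: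
`Λ*_μ(x) = sup_t (xt − log ∫ e^{ty} dμ(y))`, the supremum over all `t` with finite
exponential moment. -/
noncomputable def cramer1 (μ : Measure ℝ) (x : ℝ) : ℝ :=
  ⨆ t : {t : ℝ // Integrable (fun y => Real.exp (t * y)) μ},
    (x * t.1 - Real.log (∫ y, Real.exp (t.1 * y) ∂μ))

/-- Log-concavity of a real function, in multiplicative form. -/
def IsLogConcave (f : ℝ → ℝ) : Prop :=
  ∀ x y : ℝ, ∀ l ∈ Set.Ioo (0 : ℝ) 1, f x ^ (1 - l) * f y ^ l ≤ f ((1 - l) * x + l * y)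

/-- The tail function `x ↦ ∫_x^∞ f`. -/
noncomputable def tailIntegral (f : ℝ → ℝ) (x : ℝ) : ℝ := ∫ y in Ioi x, f y

namespace IsLogConcave

variable {f : ℝ → ℝ}

theorem comp_neg (hf : IsLogConcave f) : IsLogConcave fun x => f (-x) := by
  intro x y l hl
  have := hf (-x) (-y) l hl
  rwa [show (1 - l) * -x + l * -y = -((1 - l) * x + l * y) by ring] at this

theorem convex_superlevel (hf : IsLogConcave f) (hf0 : ∀ x, 0 ≤ f x) {c : ℝ} (hc : 0 < c) :
    Convex ℝ (f ⁻¹' Ici c) := by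
  rw [convex_iff_forall_pos]
  intro x hx y hy a b ha hb hab
  obtain rfl : a = 1 - b := by linarith
  have hx' : c ≤ f x := hx
  have hy' : c ≤ f y := hy
  refine le_trans ?_ (hf x y b ⟨hb, by linarith⟩)
  calc c = c ^ (1 - b) * c ^ b := by rw [← rpow_add hc]; simp
    _ ≤ _ := by have := hf0 x; gcongr

theorem measurable (hf : IsLogConcave f) (hf0 : ∀ x, 0 ≤ f x) : Measurable f := by
  refine measurable_of_Ici fun c => ?_
  rcases le_or_gt c 0 with hc | hc
  · convert MeasurableSet.univ
    exact eq_univ_of_forall fun x => hc.trans (hf0 x)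
  · exact (hf.convex_superlevel hf0 hc).ordConnected.measurableSet

theorem pos_combo (hf : IsLogConcave f) {x y l : ℝ} (hx : 0 < f x) (hy : 0 < f y)
    (hl : l ∈ Ioo (0 : ℝ) 1) : 0 < f ((1 - l) * x + l * y) :=
  lt_of_lt_of_le (by positivity) (hf x y l hl)

theorem convex_support (hf : IsLogConcave f) (hf0 : ∀ x, 0 ≤ f x) :
    Convex ℝ (Function.support f) := by
  rw [convex_iff_forall_pos]
  intro x hx y hy a b ha hb hab
  obtain rfl : a = 1 - b := by linarith
  exact (hf.pos_combo ((hf0 x).lt_of_ne' hx) ((hf0 y).lt_of_ne' hy) ⟨hb, by linarith⟩).ne'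

theorem concaveOn_log (hf : IsLogConcave f) (hf0 : ∀ x, 0 ≤ f x) :
    ConcaveOn ℝ (Function.support f) fun x => Real.log (f x) := by
  rw [concaveOn_iff_forall_pos]
  refine ⟨hf.convex_support hf0, ?_⟩
  intro x hx y hy a b ha hb hab
  obtain rfl : a = 1 - b := by linarith
  have hx' := (hf0 x).lt_of_ne' hx
  have hy' := (hf0 y).lt_of_ne' hy
  simp only [smul_eq_mul]
  rw [← log_rpow hx', ← log_rpow hy', ← log_mul (by positivity) (by positivity)]
  exact log_le_log (by positivity) (hf x y b ⟨hb, by linarith⟩)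

theorem continuousAt (hf : IsLogConcave f) (hf0 : ∀ x, 0 ≤ f x) {x : ℝ}
    (hx : x ∈ interior (Function.support f)) : ContinuousAt f x := by
  have h := (hf.concaveOn_log hf0).continuousOn_interior.continuousAt
    (isOpen_interior.mem_nhds hx)
  refine (continuous_exp.continuousAt.comp h).congr ?_
  filter_upwards [isOpen_interior.mem_nhds hx] with y hy
  exact exp_log ((hf0 y).lt_of_ne' (interior_subset hy))

/-- Translation form of log-concavity: two inner points with the same sum have a larger product. -/
theorem mul_le_mul_shift (hf : IsLogConcave f) (hf0 : ∀ x, 0 ≤ f x) {x y u : ℝ} (hxy : x ≤ y)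
    (hu : 0 ≤ u) : f x * f (y + u) ≤ f y * f (x + u) := by
  rcases hxy.eq_or_lt with rfl | hxy
  · rfl
  rcases hu.eq_or_lt with rfl | hu
  · simp [mul_comm]
  have hD : 0 < y + u - x := by linarith
  set l := (y - x) / (y + u - x) with hl
  have hl0 : 0 < l := div_pos (by linarith) hD
  have hl1 : l < 1 := (div_lt_one hD).2 (by linarith)
  have hlD : l * (y + u - x) = y - x := div_mul_cancel₀ _ hD.ne'
  have h1 := hf x (y + u) l ⟨hl0, hl1⟩
  have h2 := hf x (y + u) (1 - l) ⟨by linarith, by linarith⟩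
  rw [show (1 - l) * x + l * (y + u) = y by linarith] at h1
  rw [show (1 - (1 - l)) * x + (1 - l) * (y + u) = x + u by linarith, sub_sub_cancel] at h2
  rcases (hf0 x).eq_or_lt with h0 | hx
  · rw [← h0, zero_mul]; exact mul_nonneg (hf0 _) (hf0 _)
  rcases (hf0 (y + u)).eq_or_lt with h0 | hyu
  · rw [← h0, mul_zero]; exact mul_nonneg (hf0 _) (hf0 _)
  calc f x * f (y + u)
      = (f x ^ (1 - l) * f x ^ l) * (f (y + u) ^ l * f (y + u) ^ (1 - l)) := by
        rw [← rpow_add hx, ← rpow_add hyu]; simp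
    _ = (f x ^ (1 - l) * f (y + u) ^ l) * (f x ^ l * f (y + u) ^ (1 - l)) := by ring
    _ ≤ _ := by have := hf0 y; gcongr

/-- The hazard rate of a log-concave function is nondecreasing. -/
theorem mul_tailIntegral_le (hf : IsLogConcave f) (hf0 : ∀ x, 0 ≤ f x) (hfi : Integrable f)
    {x y : ℝ} (hxy : x ≤ y) : f x * tailIntegral f y ≤ f y * tailIntegral f x := by
  have shift : ∀ z, tailIntegral f z = ∫ u in Ioi 0, f (z + u) := fun z => by
    have h := (measurePreserving_add_left volume z).setIntegral_preimage_emb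
      (measurableEmbedding_addLeft z) f (Ioi z)
    rw [preimage_const_add_Ioi, sub_self] at h
    exact h.symm
  have hi : ∀ z, IntegrableOn (fun u => f (z + u)) (Ioi 0) := fun z =>
    (hfi.comp_add_left z).integrableOn
  rw [shift, shift, ← integral_const_mul, ← integral_const_mul]
  exact setIntegral_mono_on ((hi y).const_mul _) ((hi x).const_mul _) measurableSet_Ioi
    fun u hu => hf.mul_le_mul_shift hf0 hxy (le_of_lt hu)

theorem hasDerivAt_tailIntegral (hf : IsLogConcave f) (hf0 : ∀ x, 0 ≤ f x) (hfi : Integrable f)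
    {x : ℝ} (hx : x ∈ interior (Function.support f)) :
    HasDerivAt (tailIntegral f) (-f x) x := by
  have h := (intervalIntegral.integral_hasDerivAt_right (a := x) (b := x)
    hfi.intervalIntegrable
    hfi.aestronglyMeasurable.stronglyMeasurableAtFilter (hf.continuousAt hf0 hx)).const_sub
    (tailIntegral f x)
  refine h.congr_of_eventuallyEq (Filter.Eventually.of_forall fun y => ?_)
  simp only [tailIntegral]
  rw [← intervalIntegral.integral_Ioi_sub_Ioi' hfi.integrableOn hfi.integrableOn, sub_sub_cancel]

theorem tailIntegral_pos (hf0 : ∀ x, 0 ≤ f x) (hfi : Integrable f)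
    {x : ℝ} (hx : x ∈ interior (Function.support f)) : 0 < tailIntegral f x := by
  rw [tailIntegral, setIntegral_pos_iff_support_of_nonneg_ae
    (Filter.Eventually.of_forall hf0) hfi.integrableOn]
  have hne : (interior (Function.support f) ∩ Ioi x).Nonempty := by
    have h : ∀ᶠ z in nhdsWithin x (Ioi x), z ∈ interior (Function.support f) :=
      nhdsWithin_le_nhds (isOpen_interior.mem_nhds hx)
    exact (h.and self_mem_nhdsWithin).exists
  exact ((isOpen_interior.inter isOpen_Ioi).measure_pos volume hne).trans_le
    (measure_mono (inter_subset_inter_left _ interior_subset))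

theorem convex_interior_support (hf : IsLogConcave f) (hf0 : ∀ x, 0 ≤ f x) :
    Convex ℝ (interior (Function.support f)) := (hf.convex_support hf0).interior

/-- Prékopa's theorem for the tail function of a log-concave function on the line. -/
theorem concaveOn_log_tailIntegral (hf : IsLogConcave f) (hf0 : ∀ x, 0 ≤ f x)
    (hfi : Integrable f) :
    ConcaveOn ℝ (interior (Function.support f)) fun x => Real.log (tailIntegral f x) := by
  have hd : ∀ x ∈ interior (Function.support f),
      HasDerivAt (fun x => Real.log (tailIntegral f x)) (-f x / tailIntegral f x) x := fun x hx =>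
    (hf.hasDerivAt_tailIntegral hf0 hfi hx).log (tailIntegral_pos hf0 hfi hx).ne'
  refine AntitoneOn.concaveOn_of_deriv (hf.convex_interior_support hf0)
    (fun x hx => (hd x hx).continuousAt.continuousWithinAt) ?_ ?_
  · rw [interior_interior]
    exact fun x hx => (hd x hx).differentiableAt.differentiableWithinAt
  · rw [interior_interior]
    intro x hx y hy hxy
    rw [(hd x hx).deriv, (hd y hy).deriv, neg_div, neg_div, neg_le_neg_iff,
      div_le_div_iff₀ (tailIntegral_pos hf0 hfi hx) (tailIntegral_pos hf0 hfi hy)]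
    exact hf.mul_tailIntegral_le hf0 hfi hxy

theorem log_tailIntegral_le (hf : IsLogConcave f) (hf0 : ∀ x, 0 ≤ f x) (hfi : Integrable f)
    {x y : ℝ} (hx : x ∈ interior (Function.support f)) (hy : y ∈ interior (Function.support f)) :
    Real.log (tailIntegral f y) ≤
      Real.log (tailIntegral f x) - f x / tailIntegral f x * (y - x) := by
  have hc := hf.concaveOn_log_tailIntegral hf0 hfi
  have hd := (hf.hasDerivAt_tailIntegral hf0 hfi hx).log (tailIntegral_pos hf0 hfi hx).ne'
  rw [neg_div] at hd
  rcases lt_trichotomy x y with h | rfl | h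
  · have := hc.slope_le_of_hasDerivAt hx hy h hd
    rw [slope_def_field, div_le_iff₀ (by linarith)] at this
    linarith
  · simp
  · have := hc.le_slope_of_hasDerivAt hy hx h hd
    rw [slope_def_field, le_div_iff₀ (by linarith)] at this
    linarith

theorem tailIntegral_injOn (hf : IsLogConcave f) (hf0 : ∀ x, 0 ≤ f x) (hfi : Integrable f) :
    InjOn (tailIntegral f) (interior (Function.support f)) := by
  refine (strictAntiOn_of_deriv_neg (hf.convex_interior_support hf0) (fun x hx =>
    (hf.hasDerivAt_tailIntegral hf0 hfi hx).continuousAt.continuousWithinAt) fun x hx => ?_).injOn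
  rw [interior_interior] at hx
  rw [(hf.hasDerivAt_tailIntegral hf0 hfi hx).deriv, neg_lt_zero]
  exact (hf0 x).lt_of_ne' (interior_subset hx)

/-- A power of the tail function has bounded integral, as the tail of `X` is uniform. -/
theorem lintegral_tailIntegral_rpow_le (hf : IsLogConcave f) (hf0 : ∀ x, 0 ≤ f x)
    (hfi : Integrable f) (h1 : ∫ x, f x = 1) {ε : ℝ} (hε : 0 < ε) :
    ∫⁻ y in interior (Function.support f), ENNReal.ofReal (f y * tailIntegral f y ^ (ε - 1)) ≤
      ENNReal.ofReal (1 / ε) := by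
  have hcv := lintegral_image_eq_lintegral_abs_deriv_mul
    (isOpen_interior (s := Function.support f)).measurableSet
    (fun x hx => (hf.hasDerivAt_tailIntegral hf0 hfi hx).hasDerivWithinAt)
    (hf.tailIntegral_injOn hf0 hfi) (fun u => ENNReal.ofReal (u ^ (ε - 1)))
  have heq : ∫⁻ y in interior (Function.support f),
      ENNReal.ofReal (f y * tailIntegral f y ^ (ε - 1)) =
      ∫⁻ u in tailIntegral f '' interior (Function.support f),
        ENNReal.ofReal (u ^ (ε - 1)) := by
    rw [hcv]
    refine lintegral_congr fun y => ?_
    rw [abs_neg, abs_of_nonneg (hf0 y), ENNReal.ofReal_mul (hf0 y)]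
  have hsub : tailIntegral f '' interior (Function.support f) ⊆ Ioc 0 1 := by
    rintro _ ⟨x, hx, rfl⟩
    exact ⟨tailIntegral_pos hf0 hfi hx, h1 ▸
      setIntegral_le_integral hfi (Filter.Eventually.of_forall hf0)⟩
  rw [heq]
  refine (lintegral_mono_set hsub).trans (le_of_eq ?_)
  have hint : IntegrableOn (fun u : ℝ => u ^ (ε - 1)) (Ioc 0 1) :=
    (intervalIntegrable_iff_integrableOn_Ioc_of_le zero_le_one).1
      (intervalIntegral.intervalIntegrable_rpow' (by linarith))
  rw [← ofReal_integral_eq_lintegral_ofReal hint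
    ((ae_restrict_mem measurableSet_Ioc).mono fun u hu => rpow_nonneg hu.1.le _),
    ← intervalIntegral.integral_of_le zero_le_one, integral_rpow (Or.inl (by linarith))]
  simp [hε.ne']

theorem lintegral_exp_le (hf : IsLogConcave f) (hf0 : ∀ x, 0 ≤ f x)
    (hfi : Integrable f) (h1 : ∫ x, f x = 1) {ε : ℝ} (hε : ε ∈ Ioo (0 : ℝ) 1) {x : ℝ}
    (hx : x ∈ interior (Function.support f)) :
    ∃ t : ℝ, ∫⁻ y, ENNReal.ofReal (f y * rexp (t * (y - x))) ≤
      ENNReal.ofReal (tailIntegral f x ^ (1 - ε) / ε) := by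
  refine ⟨(1 - ε) * (f x / tailIntegral f x), ?_⟩
  have hGx := tailIntegral_pos hf0 hfi hx
  have hsupp : ∫⁻ y, ENNReal.ofReal
      (f y * rexp ((1 - ε) * (f x / tailIntegral f x) * (y - x))) =
      ∫⁻ y in interior (Function.support f), ENNReal.ofReal
      (f y * rexp ((1 - ε) * (f x / tailIntegral f x) * (y - x))) := by
    rw [setLIntegral_congr (interior_ae_eq_of_null_frontier
      ((hf.convex_support hf0).addHaar_frontier volume)), setLIntegral_eq_of_support_subset]
    intro y hy hy0
    simp [hy0] at hy
  rw [hsupp, div_eq_mul_one_div (_ ^ _), ENNReal.ofReal_mul (by positivity)]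
  grw [← hf.lintegral_tailIntegral_rpow_le hf0 hfi h1 hε.1]
  rw [← lintegral_const_mul' _ _ ENNReal.ofReal_ne_top]
  refine setLIntegral_mono' isOpen_interior.measurableSet fun y hy => ?_
  rw [← ENNReal.ofReal_mul (by positivity)]
  refine ENNReal.ofReal_le_ofReal ?_
  have hGy := tailIntegral_pos hf0 hfi hy
  rw [mul_left_comm, rpow_def_of_pos hGx, rpow_def_of_pos hGy, ← Real.exp_add]
  refine mul_le_mul_of_nonneg_left (Real.exp_le_exp.2 ?_) (hf0 y)
  have := mul_le_mul_of_nonneg_left (hf.log_tailIntegral_le hf0 hfi hx hy)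
    (sub_nonneg.2 hε.2.le)
  linarith

theorem interior_closure_support (hf : IsLogConcave f) (hf0 : ∀ x, 0 ≤ f x) :
    interior (closure (Function.support f)) = interior (Function.support f) := by
  have hc := hf.convex_support hf0
  rcases (Function.support f).subsingleton_or_nontrivial with h | h
  · rw [h.isClosed.closure_eq]
  · exact hc.interior_closure_eq_interior_of_nonempty_interior
      (hc.nontrivial_iff_nonempty_interior.1 h)

end IsLogConcave

/-- A bound on a single exponential moment bounds the Cramér transform from below. -/
theorem le_cramer1_of_lintegral_le (μ : Measure ℝ) [IsProbabilityMeasure μ] {x t C : ℝ}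
    (hq : 0 < depth1 μ x) (hC : 0 < C)
    (h : ∫⁻ y, ENNReal.ofReal (rexp (t * (y - x))) ∂μ ≤ ENNReal.ofReal C) :
    -Real.log C ≤ cramer1 μ x := by
  have hbdd : BddAbove (range fun t : {t : ℝ // Integrable (fun y => rexp (t * y)) μ} =>
      x * t.1 - Real.log (∫ y, rexp (t.1 * y) ∂μ)) := by
    refine ⟨-Real.log (depth1 μ x), ?_⟩
    rintro _ ⟨⟨s, hs⟩, rfl⟩
    have hle : depth1 μ x ≤ rexp (-s * x) * ∫ y, rexp (s * y) ∂μ := by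
      rcases le_total 0 s with h0 | h0
      · exact (min_le_right _ _).trans
          (ProbabilityTheory.measure_ge_le_exp_mul_mgf (X := id) x h0 hs)
      · exact (min_le_left _ _).trans
          (ProbabilityTheory.measure_le_le_exp_mul_mgf (X := id) x h0 hs)
    have hlog := log_le_log hq hle
    rw [log_mul (exp_pos _).ne' (integral_exp_pos hs).ne', log_exp] at hlog
    simp only
    linarith
  have hmeas : AEStronglyMeasurable (fun y => rexp (t * (y - x))) μ := by fun_prop
  have hi : Integrable (fun y => rexp (t * (y - x))) μ :=
    ⟨hmeas, (hasFiniteIntegral_iff_ofReal (Filter.Eventually.of_forall fun _ => (exp_pos _).le)).2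
      (h.trans_lt ENNReal.ofReal_lt_top)⟩
  have hle : ∫ y, rexp (t * (y - x)) ∂μ ≤ C := by
    rwa [← ofReal_integral_eq_lintegral_ofReal hi
      (Filter.Eventually.of_forall fun _ => (exp_pos _).le),
      ENNReal.ofReal_le_ofReal_iff hC.le] at h
  have hexp : (fun y => rexp (t * y)) = fun y => rexp (t * x) * rexp (t * (y - x)) := by
    funext y
    rw [← Real.exp_add]
    ring_nf
  have ht : Integrable (fun y => rexp (t * y)) μ := hexp ▸ hi.const_mul _
  refine le_trans ?_ (le_ciSup hbdd ⟨t, ht⟩)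
  rw [hexp, integral_const_mul, log_mul (exp_pos _).ne' (integral_exp_pos hi).ne', log_exp]
  have := log_le_log (integral_exp_pos hi) hle
  linarith

theorem cramer1_nonneg (μ : Measure ℝ) [IsProbabilityMeasure μ] (x : ℝ) : 0 ≤ cramer1 μ x := by
  by_cases hb : BddAbove (range fun t : {t : ℝ // Integrable (fun y => rexp (t * y)) μ} =>
      x * t.1 - Real.log (∫ y, rexp (t.1 * y) ∂μ))
  · exact le_trans (by simp) (le_ciSup hb ⟨0, by simp⟩)
  · exact (Real.iSup_of_not_bddAbove hb).ge

namespace IsLogConcave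

variable {f : ℝ → ℝ}

theorem exists_lintegral_exp_withDensity_le (hf : IsLogConcave f) (hf0 : ∀ x, 0 ≤ f x)
    (hfi : Integrable f) (h1 : ∫ x, f x = 1) {ε : ℝ} (hε : ε ∈ Ioo (0 : ℝ) 1) {x : ℝ}
    (hx : x ∈ interior (Function.support f)) :
    ∃ t : ℝ, ∫⁻ y, ENNReal.ofReal (rexp (t * (y - x)))
        ∂(volume.withDensity fun x => ENNReal.ofReal (f x)) ≤
      ENNReal.ofReal
        (depth1 (volume.withDensity fun x => ENNReal.ofReal (f x)) x ^ (1 - ε) / ε) := by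
  have hdens : ∀ t, ∫⁻ y, ENNReal.ofReal (rexp (t * (y - x)))
      ∂(volume.withDensity fun x => ENNReal.ofReal (f x)) =
      ∫⁻ y, ENNReal.ofReal (f y * rexp (t * (y - x))) := fun t => by
    rw [lintegral_withDensity_eq_lintegral_mul _ (hf.measurable hf0).ennreal_ofReal
      (by fun_prop)]
    simp only [Pi.mul_apply, ENNReal.ofReal_mul (hf0 _)]
  have hset : ∀ s, MeasurableSet s →
      ((volume.withDensity fun x => ENNReal.ofReal (f x)) s).toReal = ∫ y in s, f y :=
    fun s hs => by
      rw [withDensity_apply _ hs, integral_eq_lintegral_of_nonneg_ae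
        (Filter.Eventually.of_forall hf0) hfi.aestronglyMeasurable.restrict]
  simp only [hdens, depth1, hset _ measurableSet_Iic, hset _ measurableSet_Ici]
  rcases min_choice (∫ y in Iic x, f y) (∫ y in Ici x, f y) with h | h
  · have hx' : -x ∈ interior (Function.support fun y => f (-y)) := by
      have : (Function.support fun y => f (-y)) = Homeomorph.neg ℝ ⁻¹' Function.support f := rfl
      rw [this, ← (Homeomorph.neg ℝ).preimage_interior]
      simpa using hx
    obtain ⟨t, ht⟩ := hf.comp_neg.lintegral_exp_le (fun y => hf0 (-y)) hfi.comp_neg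
      (by rw [integral_neg_eq_self, h1]) hε hx'
    refine ⟨-t, ?_⟩
    rw [tailIntegral, integral_comp_neg_Ioi, neg_neg] at ht
    rw [h]
    refine le_trans (le_of_eq ?_) ht
    rw [← (Measure.measurePreserving_neg volume).lintegral_comp_emb
      (MeasurableEquiv.neg ℝ).measurableEmbedding]
    refine lintegral_congr fun y => ?_
    ring_nf
  · rw [h, integral_Ici_eq_integral_Ioi]
    exact hf.lintegral_exp_le hf0 hfi h1 hε hx

end IsLogConcave

/-- Let `μ` be an absolutely continuous log-concave probability measure on `ℝ`
(with log-concave density `f`). For every `ε ∈ (0,1)` and every `x` in the interior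
of the support of `μ`, `Λ*_μ(x) ≥ (1−ε) log(1/q_μ(x)) + log(ε / 2^{1−ε})`. -/
theorem cramer_ge_of_logConcave (μ : Measure ℝ) [IsProbabilityMeasure μ] (f : ℝ → ℝ)
    (hf0 : ∀ x, 0 ≤ f x)
    (hμ : μ = MeasureTheory.volume.withDensity fun x => ENNReal.ofReal (f x))
    (hlc : ∀ x y : ℝ, ∀ l ∈ Set.Ioo (0 : ℝ) 1,
      f x ^ (1 - l) * f y ^ l ≤ f ((1 - l) * x + l * y)) :
    ∀ ε ∈ Set.Ioo (0 : ℝ) 1, ∀ x ∈ interior (closure (Function.support f)),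
      (1 - ε) * Real.log (1 / depth1 μ x) + Real.log (ε / 2 ^ (1 - ε)) ≤ cramer1 μ x := by
  intro ε hε x hx
  have hf : IsLogConcave f := hlc
  rw [hf.interior_closure_support hf0] at hx
  have hlint : ∫⁻ y, ENNReal.ofReal (f y) = 1 := by
    rw [← setLIntegral_univ, ← withDensity_apply _ MeasurableSet.univ, ← hμ, measure_univ]
  have hfi : Integrable f := ⟨(hf.measurable hf0).aestronglyMeasurable,
    (hasFiniteIntegral_iff_ofReal (Filter.Eventually.of_forall hf0)).2 (by simp [hlint])⟩
  have h1 : ∫ y, f y = 1 := by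
    rw [integral_eq_lintegral_of_nonneg_ae (Filter.Eventually.of_forall hf0)
      hfi.aestronglyMeasurable, hlint, ENNReal.toReal_one]
  have hpow : (1 : ℝ) ≤ 2 ^ (1 - ε) := one_le_rpow one_le_two (by linarith [hε.2])
  have hlog : Real.log (ε / 2 ^ (1 - ε)) ≤ Real.log ε :=
    log_le_log (div_pos hε.1 (by positivity)) (div_le_self hε.1.le hpow)
  have hq0 : 0 ≤ depth1 μ x := le_min ENNReal.toReal_nonneg ENNReal.toReal_nonneg
  rcases hq0.eq_or_lt with hq | hq
  · rw [← hq]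
    have := cramer1_nonneg μ x
    have := log_nonpos hε.1.le hε.2.le
    simp only [div_zero, log_zero, mul_zero]
    linarith
  · obtain ⟨t, ht⟩ := hf.exists_lintegral_exp_withDensity_le hf0 hfi h1 hε hx
    rw [← hμ] at ht
    have hqp : 0 < depth1 μ x ^ (1 - ε) := rpow_pos_of_pos hq _
    have := le_cramer1_of_lintegral_le μ hq (div_pos hqp hε.1) ht
    rw [log_div hqp.ne' hε.1.ne', log_rpow hq] at this
    rw [one_div, log_inv]
    linarith
end

section
/- Let E be the random vector in ℝⁿ with density c_n e^{−√(n+1)|x|}, where c_n = (n+1)^{n/2} / (n ω_n Γ(n)). Then the cumulant generating function of the first coordinate E₁ satisfies Λ_{E₁}(t) = −((n+1)/2) log(1 − t²/(n+1)) for |t| < √(n+1). -/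
open MeasureTheory Real Set

/-- The sublevel sets of the asymmetric gauge `x ↦ a‖x‖ - t x₀` are ellipsoids. -/
lemma gauge_lt_iff_sq_lt {a t s y q r : ℝ} (hta : |t| < a) (hs : 0 < s) (hr : 0 ≤ r)
    (hq : 0 ≤ q) (hrq : r ^ 2 = y ^ 2 + q) :
    a * r - t * y < s ↔
      ((a ^ 2 - t ^ 2) / a * y - t * s / a) ^ 2 + (a ^ 2 - t ^ 2) * q < s ^ 2 := by
  have ha : 0 < a := (abs_nonneg t).trans_lt hta
  have hb : 0 < a ^ 2 - t ^ 2 := sub_pos.2 (sq_lt_sq' (abs_lt.1 hta).1 (abs_lt.1 hta).2)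
  have key : s ^ 2 - (((a ^ 2 - t ^ 2) / a * y - t * s / a) ^ 2 + (a ^ 2 - t ^ 2) * q) =
      (a ^ 2 - t ^ 2) / a ^ 2 * ((s + t * y) ^ 2 - (a * r) ^ 2) := by
    rw [mul_pow, hrq]
    field_simp
    ring
  have hty : -(t * y) ≤ a * r := by
    have hyr : |y| ≤ r := abs_le_of_sq_le_sq (by linarith) hr
    calc -(t * y) ≤ |t * y| := neg_le_abs _
      _ = |t| * |y| := abs_mul _ _
      _ ≤ a * r := by gcongr
  have har : 0 ≤ a * r := by positivity
  rw [← sub_pos (b := _ + _), key, mul_pos_iff_of_pos_left (by positivity), sub_pos,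
    sq_lt_sq, abs_of_nonneg har, lt_abs]
  constructor
  · intro h
    left
    linarith
  · rintro (h | h) <;> linarith

lemma volume_gauge_lt (m : ℕ) {a t s : ℝ} (hta : |t| < a) (hs : 0 < s) :
    volume {x : EuclideanSpace ℝ (Fin (m + 1)) | a * ‖x‖ - t * x 0 < s} =
      ENNReal.ofReal (((a ^ 2 - t ^ 2) / a * √(a ^ 2 - t ^ 2) ^ m)⁻¹ * s ^ (m + 1)) *
        volume (Metric.ball (0 : EuclideanSpace ℝ (Fin (m + 1))) 1) := by
  have ha : 0 < a := (abs_nonneg t).trans_lt hta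
  have hb : 0 < a ^ 2 - t ^ 2 := sub_pos.2 (sq_lt_sq' (abs_lt.1 hta).1 (abs_lt.1 hta).2)
  set b := a ^ 2 - t ^ 2 with hb_def
  let B := (EuclideanSpace.basisFun (Fin (m + 1)) ℝ).toBasis
  let d : Fin (m + 1) → ℝ := Fin.cons (b / a) fun _ => √b
  let L := Matrix.toLin B B (Matrix.diagonal d)
  have hdet : LinearMap.det L = b / a * √b ^ m := by
    simp [L, d, LinearMap.det_toLin, Matrix.det_diagonal, Fin.prod_univ_succ]
  have hdet_pos : 0 < b / a * √b ^ m := by positivity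
  have hL : ∀ x i, L x i = d i * x i := by
    intro x i
    have := congrFun (Matrix.repr_toLin B B (Matrix.diagonal d) x) i
    simpa [B, L, Matrix.mulVec_diagonal] using this
  have hset : {x : EuclideanSpace ℝ (Fin (m + 1)) | a * ‖x‖ - t * x 0 < s} =
      L ⁻¹' Metric.ball (EuclideanSpace.single 0 (t * s / a)) s := by
    ext x
    have hnorm : ‖x‖ ^ 2 = x 0 ^ 2 + ∑ i : Fin m, x i.succ ^ 2 := by
      rw [EuclideanSpace.real_norm_sq_eq, Fin.sum_univ_succ]
    have hdist : ‖L x - EuclideanSpace.single 0 (t * s / a)‖ ^ 2 =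
        (b / a * x 0 - t * s / a) ^ 2 + b * ∑ i : Fin m, x i.succ ^ 2 := by
      rw [EuclideanSpace.real_norm_sq_eq, Fin.sum_univ_succ]
      simp [hL, d, mul_pow, Real.sq_sqrt hb.le, Finset.mul_sum]
    rw [mem_ofPred_eq, mem_preimage, mem_ball_iff_norm,
      gauge_lt_iff_sq_lt hta hs (norm_nonneg x)
        (Finset.sum_nonneg fun i _ => sq_nonneg _) hnorm, ← hb_def, ← hdist,
      sq_lt_sq₀ (norm_nonneg _) hs.le]
  rw [hset, Measure.addHaar_preimage_linearMap _ (by rw [hdet]; exact hdet_pos.ne'), hdet,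
    Measure.addHaar_ball _ _ hs.le, ← mul_assoc, finrank_euclideanSpace_fin,
    abs_of_pos (inv_pos.2 hdet_pos), ENNReal.ofReal_mul (inv_pos.2 hdet_pos).le]

lemma lintegral_exp_neg_eq_lintegral_measure_lt {α : Type*} [MeasurableSpace α]
    {μ : Measure α} [SFinite μ] {h : α → ℝ} (hm : Measurable h) (h0 : ∀ x, 0 ≤ h x) :
    ∫⁻ x, ENNReal.ofReal (exp (-h x)) ∂μ =
      ∫⁻ s in Ioi (0 : ℝ), ENNReal.ofReal (exp (-s)) * μ {x | h x < s} := by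
  have hinner : ∀ x, ENNReal.ofReal (exp (-h x)) =
      ∫⁻ s in Ioi (0 : ℝ), (Ioi (h x)).indicator (fun s => ENNReal.ofReal (exp (-s))) s := by
    intro x
    rw [lintegral_indicator measurableSet_Ioi, Measure.restrict_restrict measurableSet_Ioi,
      inter_eq_left.2 (Ioi_subset_Ioi (h0 x)), ← integral_exp_neg_Ioi (h x),
      ofReal_integral_eq_lintegral_ofReal]
    · exact integrableOn_exp_neg_Ioi (h x)
    · exact Filter.Eventually.of_forall fun s => (exp_pos _).le
  simp_rw [hinner]
  rw [lintegral_lintegral_swap]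
  · refine lintegral_congr fun s => ?_
    have : (fun x => (Ioi (h x)).indicator (fun s => ENNReal.ofReal (exp (-s))) s) =
        {x | h x < s}.indicator fun _ => ENNReal.ofReal (exp (-s)) := by
      ext x
      simp [indicator]
    rw [this, lintegral_indicator_const (measurableSet_lt hm measurable_const)]
  · have hmeas : MeasurableSet {p : α × ℝ | h p.1 < p.2} :=
      measurableSet_lt (hm.comp measurable_fst) measurable_snd
    have : Measurable ({p : α × ℝ | h p.1 < p.2}.indicator
        fun p => ENNReal.ofReal (exp (-p.2))) := by
      refine Measurable.indicator ?_ hmeas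
      fun_prop
    exact this.aemeasurable

lemma lintegral_exp_neg_gauge (m : ℕ) {a t : ℝ} (hta : |t| < a) :
    ∫⁻ x : EuclideanSpace ℝ (Fin (m + 1)), ENNReal.ofReal (exp (-(a * ‖x‖ - t * x 0))) =
      ENNReal.ofReal (((a ^ 2 - t ^ 2) / a * √(a ^ 2 - t ^ 2) ^ m)⁻¹ * Gamma (m + 2)) *
        volume (Metric.ball (0 : EuclideanSpace ℝ (Fin (m + 1))) 1) := by
  have ha : 0 < a := (abs_nonneg t).trans_lt hta
  have hb : 0 < a ^ 2 - t ^ 2 := sub_pos.2 (sq_lt_sq' (abs_lt.1 hta).1 (abs_lt.1 hta).2)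
  have hnonneg : ∀ x : EuclideanSpace ℝ (Fin (m + 1)), 0 ≤ a * ‖x‖ - t * x 0 := by
    intro x
    have hx : |x 0| ≤ ‖x‖ := by simpa using PiLp.norm_apply_le x 0
    rw [sub_nonneg]
    calc t * x 0 ≤ |t * x 0| := le_abs_self _
      _ = |t| * |x 0| := abs_mul _ _
      _ ≤ a * ‖x‖ := by gcongr
  have hK : 0 ≤ ((a ^ 2 - t ^ 2) / a * √(a ^ 2 - t ^ 2) ^ m)⁻¹ := by positivity
  rw [lintegral_exp_neg_eq_lintegral_measure_lt (by fun_prop) hnonneg]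
  have hcongr : ∀ s ∈ Ioi (0 : ℝ), ENNReal.ofReal (exp (-s)) *
      volume {x : EuclideanSpace ℝ (Fin (m + 1)) | a * ‖x‖ - t * x 0 < s} =
      ENNReal.ofReal ((a ^ 2 - t ^ 2) / a * √(a ^ 2 - t ^ 2) ^ m)⁻¹ *
        volume (Metric.ball (0 : EuclideanSpace ℝ (Fin (m + 1))) 1) *
        ENNReal.ofReal (exp (-s) * s ^ ((m + 2 : ℝ) - 1)) := by
    intro s hs
    have hpow : s ^ ((m + 2 : ℝ) - 1) = s ^ (m + 1) := by
      rw [← rpow_natCast]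
      congr 1
      push_cast
      ring
    rw [volume_gauge_lt m hta hs, hpow, ENNReal.ofReal_mul hK,
      ENNReal.ofReal_mul (exp_pos _).le]
    ring
  rw [setLIntegral_congr_fun measurableSet_Ioi hcongr, lintegral_const_mul _ (by fun_prop),
    ← ofReal_integral_eq_lintegral_ofReal (GammaIntegral_convergent (by positivity)),
    ← Gamma_eq_integral (by positivity), ENNReal.ofReal_mul hK]
  · ring
  · filter_upwards [ae_restrict_mem measurableSet_Ioi] with s hs
    have : (0 : ℝ) < s := hs
    positivity

/-- Let `E` be the isotropic rotationally invariant exponential random vector in `ℝⁿ`,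
with density `c_n e^{−√(n+1)|x|}` where `c_n = (n+1)^{n/2} / (n ω_n Γ(n))` and `ω_n` is
the volume of the unit Euclidean ball. Then the cumulant generating function of the
first coordinate satisfies `Λ_{E₁}(t) = −((n+1)/2) log(1 − t²/(n+1))` for `|t| < √(n+1)`. -/
theorem logLaplace_exponential_marginal {n : ℕ} (hn : 0 < n)
    (μ : Measure (EuclideanSpace ℝ (Fin n)))
    (hμ : μ = MeasureTheory.volume.withDensity fun x : EuclideanSpace ℝ (Fin n) =>
      ENNReal.ofReal
        (((n : ℝ) + 1) ^ ((n : ℝ) / 2) /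
            ((n : ℝ) *
              (MeasureTheory.volume (Metric.ball (0 : EuclideanSpace ℝ (Fin n)) 1)).toReal *
              Real.Gamma n) *
          Real.exp (-Real.sqrt ((n : ℝ) + 1) * ‖x‖))) :
    ∀ t : ℝ, |t| < Real.sqrt ((n : ℝ) + 1) →
      Real.log (∫ x, Real.exp (t * x ⟨0, hn⟩) ∂μ) =
        -(((n : ℝ) + 1) / 2) * Real.log (1 - t ^ 2 / ((n : ℝ) + 1)) := by
  obtain ⟨m, rfl⟩ : ∃ m, n = m + 1 := ⟨n - 1, by omega⟩
  intro t ht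
  set V := volume (Metric.ball (0 : EuclideanSpace ℝ (Fin (m + 1))) 1)
  have hV : 0 < V.toReal :=
    ENNReal.toReal_pos (Metric.measure_ball_pos _ _ one_pos).ne' measure_ball_lt_top.ne
  set N : ℝ := ((m + 1 : ℕ) : ℝ) with hN_def
  have hN : 0 < N := by positivity
  have ha2 : √(N + 1) ^ 2 = N + 1 := sq_sqrt (by positivity)
  have hΓ : 0 < Gamma N := Gamma_pos_of_pos hN
  set c := (N + 1) ^ (N / 2) / (N * V.toReal * Gamma N) with hc_def
  have hc : 0 < c := by positivity
  have hb : 0 < N + 1 - t ^ 2 := by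
    rw [← ha2]
    exact sub_pos.2 (sq_lt_sq' (abs_lt.1 ht).1 (abs_lt.1 ht).2)
  have hΓ' : Gamma ((m : ℝ) + 2) = N * Gamma N := by
    rw [← Gamma_add_one hN.ne', hN_def]
    congr 1
    push_cast
    ring
  have hint : ∫ x : EuclideanSpace ℝ (Fin (m + 1)), exp (t * x ⟨0, hn⟩) ∂μ =
      c * ((((N + 1 - t ^ 2) / √(N + 1) * √(N + 1 - t ^ 2) ^ m)⁻¹ * (N * Gamma N)) *
        V.toReal) := by
    rw [integral_eq_lintegral_of_nonneg_ae
      (Filter.Eventually.of_forall fun x => (exp_pos _).le)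
      (by fun_prop), hμ, lintegral_withDensity_eq_lintegral_mul _ (by fun_prop) (by fun_prop)]
    have hcongr : ∀ x : EuclideanSpace ℝ (Fin (m + 1)),
        ((fun x : EuclideanSpace ℝ (Fin (m + 1)) =>
            ENNReal.ofReal (c * exp (-√(N + 1) * ‖x‖))) *
          fun x : EuclideanSpace ℝ (Fin (m + 1)) => ENNReal.ofReal (exp (t * x ⟨0, hn⟩))) x =
        ENNReal.ofReal c * ENNReal.ofReal (exp (-(√(N + 1) * ‖x‖ - t * x 0))) := by
      intro x
      rw [Pi.mul_apply, ← ENNReal.ofReal_mul (by positivity), ← ENNReal.ofReal_mul hc.le,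
        mul_assoc, ← exp_add]
      congr 3
      change _ + t * x 0 = _
      ring
    rw [lintegral_congr hcongr, lintegral_const_mul _ (by fun_prop),
      lintegral_exp_neg_gauge m ht, ha2, hΓ', ENNReal.toReal_mul, ENNReal.toReal_mul,
      ENNReal.toReal_ofReal hc.le, ENNReal.toReal_ofReal (by positivity)]
  have hval : c * ((((N + 1 - t ^ 2) / √(N + 1) * √(N + 1 - t ^ 2) ^ m)⁻¹ * (N * Gamma N)) *
        V.toReal) =
      (N + 1) ^ (N / 2) * (√(N + 1) / ((N + 1 - t ^ 2) * √(N + 1 - t ^ 2) ^ m)) := by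
    rw [hc_def]
    field_simp
  have hquot : 1 - t ^ 2 / (N + 1) = (N + 1 - t ^ 2) / (N + 1) := by
    field_simp
  have hm : (m : ℝ) = N - 1 := by simp [hN_def]
  rw [hint, hval, hquot, log_mul (by positivity) (by positivity), log_rpow (by positivity),
    log_div (by positivity) (by positivity), log_mul hb.ne' (by positivity), log_pow,
    log_sqrt (by positivity), log_sqrt hb.le, log_div hb.ne' (by positivity), hm]
  ring
end
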